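/- arXiv:math/0402310 — 2 statements merged into one kernel-verified Lean document; each statement's English description precedes it below -/
import Mathlib

section
/- Let R be a commutative Noetherian ring and let M be a finitely generated R-module of finite projective dimension. Then the union over i ∈ ℕ of Supp_R Ext^i_R(M,R) equals Supp_R M; that is, a prime ideal p of R lies in Supp_R M if and only if there is some i with (Ext^i_R(M,R))_p ≠ 0. (This is the claim Supp X* = Supp X for X of finite projective dimension, where X* = RHom_R(X,R), proved in Section 3.) -/
/-!
Common definitions: Ext modules, dimension of a module (Krull dimension of its
support, in `WithBot ℕ∞`, with `⊥` for the zero module), projective/injective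
dimension via the Ext-vanishing characterization, and cohomological dimension
with respect to an ideal via local cohomology.
-/

open CategoryTheory TensorProduct

universe u

/-- The `i`-th Ext module `Ext^i_R(M, N)` of two `R`-modules. -/
noncomputable def extMod (R : Type u) [CommRing R] (i : ℕ) (M N : ModuleCat.{u} R) :
    ModuleCat.{u} R :=
  ((Ext R (ModuleCat.{u} R) i).obj (Opposite.op M)).obj N

/-- The dimension `dim_R M` of an `R`-module: the Krull dimension of its support
`Supp_R M ⊆ Spec R`, an element of `WithBot ℕ∞` which is `⊥ = -∞` for the zero module. -/
noncomputable def supportDim (R : Type u) [CommRing R] (M : Type u) [AddCommGroup M]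
    [Module R M] : WithBot ℕ∞ :=
  Order.krullDim (Module.support R M)

/-- `M` has projective dimension at most `n`: `Ext^{n+1}_R(M, N) = 0` for every `N`. -/
def projDimLE (R : Type u) [CommRing R] (M : ModuleCat.{u} R) (n : ℕ) : Prop :=
  ∀ N : ModuleCat.{u} R, Subsingleton (extMod R (n + 1) M N)

/-- The projective dimension `proj.dim_R M`, as an element of `WithBot ℕ∞`
(it is `⊤` when `M` does not have finite projective dimension). -/
noncomputable def projDim (R : Type u) [CommRing R] (M : ModuleCat.{u} R) : WithBot ℕ∞ :=
  sInf {d : WithBot ℕ∞ | ∃ n : ℕ, d = n ∧ projDimLE R M n}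

/-- `N` has injective dimension at most `n`: `Ext^{n+1}_R(M, N) = 0` for every `M`. -/
def injDimLE (R : Type u) [CommRing R] (N : ModuleCat.{u} R) (n : ℕ) : Prop :=
  ∀ M : ModuleCat.{u} R, Subsingleton (extMod R (n + 1) M N)

/-- The cohomological dimension `cd(a, M)`: the supremum of those `i` with
`H^i_a(M) ≠ 0`, an element of `WithBot ℕ∞` which is `⊥ = -∞` when all the local
cohomology modules vanish. -/
noncomputable def cohDim (R : Type u) [CommRing R] (a : Ideal R) (M : ModuleCat.{u} R) :
    WithBot ℕ∞ :=
  ⨆ i ∈ {i : ℕ | ¬ Subsingleton ((localCohomology a i).obj M)}, (i : WithBot ℕ∞)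

section

variable {R : Type u} [CommRing R]

lemma CategoryTheory.ShortComplex.notMem_support_homology_iff (S : ShortComplex (ModuleCat.{u} R))
    (p : PrimeSpectrum R) :
    p ∉ Module.support R S.homology ↔
      ∀ x : S.X₂, S.g x = 0 → ∃ r ∉ p.asIdeal, ∃ y : S.X₁, S.f y = r • x := by
  rw [S.moduleCatHomologyIso.toLinearEquiv.support_eq, Module.notMem_support_iff']
  refine ⟨fun h x hx ↦ ?_, fun h m ↦ ?_⟩
  · obtain ⟨r, hr, e⟩ := h (Submodule.Quotient.mk (⟨x, hx⟩ : LinearMap.ker S.g.hom))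
    obtain ⟨y, hy⟩ := (Submodule.Quotient.mk_eq_zero (LinearMap.range S.moduleCatToCycles)
      (x := r • (⟨x, hx⟩ : LinearMap.ker S.g.hom))).1 e
    exact ⟨r, hr, y, congrArg Subtype.val hy⟩
  · obtain ⟨⟨x, hx⟩, rfl⟩ := Submodule.Quotient.mk_surjective _ m
    obtain ⟨r, hr, y, hy⟩ := h x hx
    exact ⟨r, hr, (Submodule.Quotient.mk_eq_zero (LinearMap.range S.moduleCatToCycles)
      (x := r • (⟨x, hx⟩ : LinearMap.ker S.g.hom))).2 ⟨y, Subtype.ext hy⟩⟩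

/-- `Ext^i(M, N)` vanishes at `p` iff every degree `i` cocycle of a projective resolution becomes a
coboundary after scaling by an element outside `p`. In degree `0` the differential into the
cocycles is `0`. -/
lemma notMem_support_extMod_iff {M : ModuleCat.{u} R} (P : ProjectiveResolution M)
    (p : PrimeSpectrum R) (i : ℕ) (N : ModuleCat.{u} R) :
    p ∉ Module.support R (extMod R i M N) ↔
      ∀ f : P.complex.X i ⟶ N, P.complex.d (i + 1) i ≫ f = 0 → ∃ r ∉ p.asIdeal,
        ∃ g : P.complex.X ((ComplexShape.up ℕ).prev i) ⟶ N,
          P.complex.d i ((ComplexShape.up ℕ).prev i) ≫ g = r • f := by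
  let K := P.complex.linearYonedaObj R N
  let e := P.isoExt (R := R) i N ≪≫
    K.homologyIsoSc' ((ComplexShape.up ℕ).prev i) i (i + 1) rfl (by simp)
  rw [show Module.support R (extMod R i M N) = _ from e.toLinearEquiv.support_eq,
    ShortComplex.notMem_support_homology_iff]
  rfl

lemma notMem_support_extMod_of_notMem_support {M : ModuleCat.{u} R} [Module.Finite R M]
    {p : PrimeSpectrum R} (hp : p ∉ Module.support R M) (i : ℕ) (N : ModuleCat.{u} R) :
    p ∉ Module.support R (extMod R i M N) := by
  rw [Module.mem_support_iff_of_finite, SetLike.not_le_iff_exists] at hp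
  obtain ⟨r, hr, hrp⟩ := hp
  let P := projectiveResolution M
  rw [notMem_support_extMod_iff P]
  have h0 : (r • 𝟙 P.complex) ≫ P.π = 0 := by
    rw [Linear.smul_comp, Category.id_comp]
    ext x
    exact Module.mem_annihilator.1 hr (show M from P.π.f 0 x)
  let H := ProjectiveResolution.liftHomotopyZero _ h0
  intro f hf
  refine ⟨r, hrp, H.hom _ i ≫ f, ?_⟩
  have hc := H.comm i
  rw [prevD_eq _ (show (ComplexShape.down ℕ).Rel (i + 1) i from rfl)] at hc
  have hcf := congr($hc ≫ f)
  simp only [Preadditive.add_comp, Category.assoc, hf, Limits.comp_zero, add_zero,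
    HomologicalComplex.zero_f, HomologicalComplex.smul_f_apply, HomologicalComplex.id_f,
    Linear.smul_comp, Category.id_comp] at hcf
  rw [hcf]
  exact (Category.assoc _ _ _).symm

lemma notMem_support_extMod_pi {M : ModuleCat.{u} R} {p : PrimeSpectrum R} {i : ℕ}
    (h : p ∉ Module.support R (extMod R i M (ModuleCat.of R R))) (k : ℕ) :
    p ∉ Module.support R (extMod R i M (ModuleCat.of R (Fin k → R))) := by
  let P := projectiveResolution M
  rw [notMem_support_extMod_iff P] at h ⊢
  intro f hf
  choose r hr g hg using fun j ↦ h (f ≫ ModuleCat.ofHom (LinearMap.proj j))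
    (by rw [reassoc_of% hf, Limits.zero_comp])
  refine ⟨∏ j, r j, fun hmem ↦ ?_, ModuleCat.ofHom
    (LinearMap.pi fun j ↦ (∏ l ∈ Finset.univ.erase j, r l) • (g j).hom), ?_⟩
  · obtain ⟨j, -, hj⟩ := (p.isPrime.prod_mem_iff).1 hmem
    exact hr j hj
  · ext x j
    have := congr($(hg j) x)
    simp at this ⊢
    rw [this, ← mul_assoc, Finset.prod_erase_mul _ _ (Finset.mem_univ j)]

lemma notMem_support_extMod_of_succ [IsNoetherianRing R] {M : ModuleCat.{u} R}
    {p : PrimeSpectrum R} {i : ℕ}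
    (hR : p ∉ Module.support R (extMod R i M (ModuleCat.of R R)))
    (hsucc : ∀ K : ModuleCat.{u} R, Module.Finite R K →
      p ∉ Module.support R (extMod R (i + 1) M K))
    (N : ModuleCat.{u} R) [Module.Finite R N] :
    p ∉ Module.support R (extMod R i M N) := by
  obtain ⟨k, π, hπ⟩ := Module.Finite.exists_fin' R N
  have hF := notMem_support_extMod_pi hR k
  have hK := hsucc (ModuleCat.of R (LinearMap.ker π)) inferInstance
  let P := projectiveResolution M
  rw [notMem_support_extMod_iff P] at hF hK ⊢
  rw [CochainComplex.prev_nat_succ] at hK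
  intro f hf
  have : Epi (ModuleCat.ofHom π) := (ModuleCat.epi_iff_surjective _).2 hπ
  let F := Projective.factorThru f (ModuleCat.ofHom π)
  have hFf : F ≫ ModuleCat.ofHom π = f := Projective.factorThru_comp _ _
  let ι : ModuleCat.of R (LinearMap.ker π) ⟶ _ := ModuleCat.ofHom (LinearMap.ker π).subtype
  have hιπ : ι ≫ ModuleCat.ofHom π = 0 := by
    ext x
    exact x.2
  let c : P.complex.X (i + 1) ⟶ ModuleCat.of R (LinearMap.ker π) :=
    ModuleCat.ofHom ((P.complex.d (i + 1) i ≫ F).hom.codRestrict _ fun x ↦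
      congr($(show (P.complex.d (i + 1) i ≫ F) ≫ ModuleCat.ofHom π = 0 by
        rw [Category.assoc, hFf, hf]) x))
  have hc : c ≫ ι = P.complex.d (i + 1) i ≫ F := rfl
  have : Mono ι := (ModuleCat.mono_iff_injective _).2 (Submodule.subtype_injective _)
  obtain ⟨s, hs, h, hh⟩ := hK c (by
    rw [← cancel_mono ι, Category.assoc, hc, P.complex.d_comp_d_assoc]; simp)
  obtain ⟨t, ht, g, hg⟩ := hF (s • F - h ≫ ι) (by
    rw [Preadditive.comp_sub, reassoc_of% hh, Linear.smul_comp, hc, Linear.comp_smul, sub_self])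
  refine ⟨t * s, fun hmem ↦ (p.isPrime.mem_or_mem hmem).elim ht hs, g ≫ ModuleCat.ofHom π, ?_⟩
  rw [reassoc_of% hg, Linear.smul_comp, Preadditive.sub_comp, Category.assoc, hιπ,
    Limits.comp_zero, sub_zero, Linear.smul_comp, hFf, smul_smul]

lemma notMem_support_of_notMem_support_extMod_zero {M : ModuleCat.{u} R} {p : PrimeSpectrum R}
    (h : p ∉ Module.support R (extMod R 0 M M)) : p ∉ Module.support R M := by
  let P := projectiveResolution M
  rw [notMem_support_extMod_iff P] at h
  obtain ⟨r, hr, g, hg⟩ := h (P.π.f 0) P.complex_d_comp_π_f_zero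
  rw [Module.notMem_support_iff']
  intro m
  obtain ⟨x, rfl⟩ := (ModuleCat.epi_iff_surjective (P.π.f 0)).1 inferInstance m
  refine ⟨r, hr, ?_⟩
  rw [P.complex.shape _ _ (by simp), Limits.zero_comp] at hg
  exact congr($hg.symm x)

end

/-- If `M` is a finitely generated module of finite projective dimension over a
commutative Noetherian ring `R`, then `⋃ i Supp_R Ext^i_R(M, R) = Supp_R M`
(the claim `Supp X* = Supp X` of Section 3). -/
theorem iUnion_support_ext_eq_support (R : Type u) [CommRing R] [IsNoetherianRing R]
    (M : ModuleCat.{u} R) [Module.Finite R M]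
    (hpd : ∃ n : ℕ, projDimLE R M n) :
    (⋃ i : ℕ, Module.support R (extMod R i M (ModuleCat.of R R))) = Module.support R M := by
  obtain ⟨n, hn⟩ := hpd
  ext p
  rw [Set.mem_iUnion, ← not_iff_not, not_exists]
  refine ⟨fun h ↦ ?_, fun h i ↦ notMem_support_extMod_of_notMem_support h i _⟩
  have vanish (i : ℕ) (hi : i ≤ n + 1) : ∀ N : ModuleCat.{u} R, Module.Finite R N →
      p ∉ Module.support R (extMod R i M N) := by
    induction hi using Nat.decreasingInduction with
    | self =>
      intro N _
      have := hn N
      simp [Module.support_eq_empty]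
    | of_succ i _ ih => exact fun N _ ↦ notMem_support_extMod_of_succ (h i) ih N
  exact notMem_support_of_notMem_support_extMod_zero (vanish 0 (Nat.zero_le _) M inferInstance)
end

section
/- Let R be a commutative Noetherian ring of finite Krull dimension, let a be an ideal of R, and let M be a finitely generated R-module. Then cd(a,M) = sup{cd(a, R/p) : p ∈ Supp_R M}; that is, for every j, H^j_a(M) ≠ 0 implies there are p ∈ Supp_R M and j' ≥ j with H^{j'}_a(R/p) ≠ 0, and conversely for every p ∈ Supp_R M and every j with H^j_a(R/p) ≠ 0 there is j' ≥ j with H^{j'}_a(M) ≠ 0. (Module case of Theorem 3.1: -inf RΓ_a(X) = cd(a,X) = sup{cd(a,R/p) - inf X_p : p ∈ Spec R} for X ∈ D^f_+(R).) -/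
/-!
Common definitions: Ext modules, dimension of a module (Krull dimension of its
support, in `WithBot ℕ∞`, with `⊥` for the zero module), projective/injective
dimension via the Ext-vanishing characterization, and cohomological dimension
with respect to an ideal via local cohomology.
-/

open CategoryTheory TensorProduct

universe u

namespace CategoryTheory

open Limits Opposite

section HomologyInjective

variable {A : Type*} [Category* A] [Abelian A] {ι : Type*} {c : ComplexShape ι}
  (K : HomologicalComplex A c) (i j k : ι) (hj : c.prev i = j) (hk : c.next i = k)
  {T : A} [Injective T]

include hk in
lemma HomologicalComplex.homologyι_descOpcycles_eq_zero_iff (f : K.X i ⟶ T)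
    (hf : K.d j i ≫ f = 0) :
    K.homologyι i ≫ K.descOpcycles f j hj hf = 0 ↔ ∃ g : K.X k ⟶ T, K.d i k ≫ g = f := by
  constructor
  · intro h
    let S : ShortComplex A := ShortComplex.mk (K.homologyι i) (K.fromOpcycles i k) (by simp)
    have hS : S.Exact := S.exact_of_f_is_kernel (K.homologyIsKernel i k hk)
    refine ⟨hS.descToInjective (K.descOpcycles f j hj hf) h, ?_⟩
    have := hS.comp_descToInjective (K.descOpcycles f j hj hf) h
    simpa [S] using congrArg (K.pOpcycles i ≫ ·) this
  · rintro ⟨g, rfl⟩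
    exact K.homologyι_descOpcycles_eq_zero_of_boundary _ j hj g rfl

lemma HomologicalComplex.exists_homologyι_descOpcycles_eq (h : K.homology i ⟶ T) :
    ∃ (f : K.X i ⟶ T) (hf : K.d j i ≫ f = 0), K.homologyι i ≫ K.descOpcycles f j hj hf = h := by
  refine ⟨K.pOpcycles i ≫ Injective.factorThru h (K.homologyι i), by simp, ?_⟩
  rw [← Injective.comp_factorThru h (K.homologyι i)]
  congr 1
  simp [← cancel_epi (K.pOpcycles i)]

end HomologyInjective

namespace ProjectiveResolution

section

variable {C : Type*} [Category* C] [Abelian C] [HasExt C] {X Y : C} (P : ProjectiveResolution X)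

lemma extMk_eq_zero_iff_next {n : ℕ} (f : P.complex.X n ⟶ Y) (m : ℕ) (hm : n + 1 = m)
    (hf : P.complex.d m n ≫ f = 0) :
    P.extMk f m hm hf = 0 ↔
      ∃ g : P.complex.X ((ComplexShape.down ℕ).next n) ⟶ Y,
        P.complex.d n ((ComplexShape.down ℕ).next n) ≫ g = f := by
  obtain _ | p := n
  · simp only [← P.extEquivCohomologyClass.apply_eq_iff_eq,
      extEquivCohomologyClass_extMk, extEquivCohomologyClass_zero,
      CochainComplex.HomComplex.CohomologyClass.mk_eq_zero_iff]
    rw [CochainComplex.HomComplex.Cocycle.toSingleMk_mem_coboundaries_iff _ _ _ _ _ 1 (by simp)]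
    have h1 : P.cochainComplex.d (-((0 : ℕ) : ℤ)) 1 = 0 := by
      apply IsZero.eq_of_tgt
      exact P.complex.isZero_extend_X _ _ (by simp; omega)
    have h2 : P.complex.d 0 ((ComplexShape.down ℕ).next 0) = 0 := P.complex.shape _ _ (by simp)
    simp only [h1, h2, Limits.zero_comp, exists_const]
    rw [eq_comm, Preadditive.IsIso.comp_left_eq_zero, eq_comm]
  · rw [P.extMk_eq_zero_iff f m hm hf p rfl, ChainComplex.next_nat_succ]

end

section

variable {R : Type u} [CommRing R] {C : Type*} [Category.{u} C] [Abelian C] [Linear R C]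
  {X X' Y : C} (P : ProjectiveResolution X)

/-- Elements of a module correspond to morphisms to the ring in the opposite category. -/
noncomputable def _root_.ModuleCat.opHomEquiv (Z : (ModuleCat.{u} R)ᵒᵖ) :
    (Z ⟶ op (ModuleCat.of R R)) ≃ Z.unop where
  toFun h := h.unop (1 : R)
  invFun z := (ModuleCat.ofHom (LinearMap.toSpanSingleton R Z.unop z)).op
  left_inv h := by
    apply Quiver.Hom.unop_inj
    ext
    exact one_smul R _
  right_inv z := one_smul R z

lemma _root_.ModuleCat.opHomEquiv_comp {Z Z' : (ModuleCat.{u} R)ᵒᵖ} (g : Z ⟶ Z')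
    (h : Z' ⟶ op (ModuleCat.of R R)) :
    ModuleCat.opHomEquiv Z (g ≫ h) = g.unop (ModuleCat.opHomEquiv Z' h) := rfl

lemma _root_.ModuleCat.opHomEquiv_zero (Z : (ModuleCat.{u} R)ᵒᵖ) :
    ModuleCat.opHomEquiv Z 0 = 0 := rfl

variable (R) in
/-- A morphism to `Y`, seen as a morphism in the opposite category of modules. -/
noncomputable def homEquivOp (Z : C) :
    (((linearYoneda R C).obj Y).rightOp.obj Z ⟶ op (ModuleCat.of R R)) ≃ (Z ⟶ Y) :=
  ModuleCat.opHomEquiv (((linearYoneda R C).obj Y).rightOp.obj Z)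

lemma homEquivOp_map_comp {Z Z' : C} (g : Z ⟶ Z')
    (h : ((linearYoneda R C).obj Y).rightOp.obj Z' ⟶ op (ModuleCat.of R R)) :
    homEquivOp R Z (((linearYoneda R C).obj Y).rightOp.map g ≫ h) = g ≫ homEquivOp R Z' h :=
  rfl

lemma map_comp_homEquivOp_symm {Z Z' : C} (g : Z ⟶ Z') (f : Z' ⟶ Y) :
    ((linearYoneda R C).obj Y).rightOp.map g ≫ (homEquivOp R Z').symm f =
      (homEquivOp R Z).symm (g ≫ f) := by
  rw [Equiv.eq_symm_apply, homEquivOp_map_comp, Equiv.apply_symm_apply]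

lemma homEquivOp_symm_zero (Z : C) : (homEquivOp R Z (Y := Y)).symm 0 = 0 := by
  rw [Equiv.symm_apply_eq]; rfl

variable (R Y) in
/-- The complex computing `Ext`, in the opposite category of modules. -/
noncomputable abbrev opComplex : ChainComplex (ModuleCat.{u} R)ᵒᵖ ℕ :=
  (((linearYoneda R C).obj Y).rightOp.mapHomologicalComplex (ComplexShape.down ℕ)).obj P.complex

lemma opComplex_d_comp {i j : ℕ} (f : P.complex.X j ⟶ Y) :
    (P.opComplex R Y).d i j ≫ (homEquivOp R _).symm f =
      (homEquivOp R (P.complex.X i)).symm (P.complex.d i j ≫ f) :=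
  map_comp_homEquivOp_symm _ _

lemma opComplex_d_comp_eq_zero {i j : ℕ} (f : P.complex.X j ⟶ Y) (hf : P.complex.d i j ≫ f = 0) :
    (P.opComplex R Y).d i j ≫ (homEquivOp R _).symm f = 0 :=
  (P.opComplex_d_comp f).trans (by rw [hf, homEquivOp_symm_zero]; rfl)

variable (R Y) in
/-- `Ext` in terms of the homology of a complex in the opposite category of modules. -/
noncomputable def leftDerivedIso [EnoughProjectives C] (n : ℕ) :
    (((linearYoneda R C).obj Y).rightOp.leftDerived n).obj X ≅ (P.opComplex R Y).homology n :=
  P.isoLeftDerivedObj ((linearYoneda R C).obj Y).rightOp n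

/-- The morphism from homology induced by a cocycle. -/
noncomputable def homologyToOp {n : ℕ} (f : P.complex.X n ⟶ Y)
    (hf : P.complex.d (n + 1) n ≫ f = 0) :
    (P.opComplex R Y).homology n ⟶ op (ModuleCat.of R R) :=
  (P.opComplex R Y).homologyι n ≫ (P.opComplex R Y).descOpcycles ((homEquivOp R _).symm f)
      (n + 1) (by simp) (P.opComplex_d_comp_eq_zero f hf)

lemma homologyMap_comp_homologyToOp (P' : ProjectiveResolution X') (φ : P'.complex ⟶ P.complex)
    {n : ℕ} (f : P.complex.X n ⟶ Y) (hf : P.complex.d (n + 1) n ≫ f = 0) :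
    HomologicalComplex.homologyMap ((((linearYoneda R C).obj Y).rightOp.mapHomologicalComplex
      (ComplexShape.down ℕ)).map φ) n ≫ P.homologyToOp f hf =
      P'.homologyToOp (φ.f n ≫ f) (by simp [← φ.comm_assoc, hf]) := by
  unfold homologyToOp
  rw [HomologicalComplex.homologyι_naturality_assoc]
  refine congrArg _ ((HomologicalComplex.opcyclesMap_comp_descOpcycles ..).trans ?_)
  congr 1
  exact map_comp_homEquivOp_symm (φ.f n) f

variable [EnoughProjectives C]

/-- The class in `Ext` of a cocycle on a projective resolution. -/
noncomputable def extClassOfCocycle {n : ℕ} (f : P.complex.X n ⟶ Y)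
    (hf : P.complex.d (n + 1) n ≫ f = 0) : ((Ext R C n).obj (op X)).obj Y :=
  ModuleCat.opHomEquiv ((((linearYoneda R C).obj Y).rightOp.leftDerived n).obj X)
    ((P.leftDerivedIso R Y n).hom ≫ P.homologyToOp f hf)

lemma exists_extClassOfCocycle_eq {n : ℕ} (α : ((Ext R C n).obj (op X)).obj Y) :
    ∃ (f : P.complex.X n ⟶ Y) (hf : P.complex.d (n + 1) n ≫ f = 0),
      P.extClassOfCocycle f hf = α := by
  let e := ModuleCat.opHomEquiv ((((linearYoneda R C).obj Y).rightOp.leftDerived n).obj X)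
  obtain ⟨f', hf', h⟩ := HomologicalComplex.exists_homologyι_descOpcycles_eq (P.opComplex R Y) n
    (n + 1) (by simp) ((P.leftDerivedIso R Y n).inv ≫ e.symm α)
  obtain ⟨f, rfl⟩ := (homEquivOp R _).symm.surjective f'
  refine ⟨f, ?_, ?_⟩
  · apply (homEquivOp R _).symm.injective
    rw [homEquivOp_symm_zero]
    exact (P.opComplex_d_comp f).symm.trans hf'
  · exact (e.eq_symm_apply).1 ((Iso.eq_inv_comp _).1 h)

lemma extClassOfCocycle_eq_zero_iff {n : ℕ} (f : P.complex.X n ⟶ Y)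
    (hf : P.complex.d (n + 1) n ≫ f = 0) :
    P.extClassOfCocycle (R := R) f hf = 0 ↔
      ∃ g : P.complex.X ((ComplexShape.down ℕ).next n) ⟶ Y,
        P.complex.d n ((ComplexShape.down ℕ).next n) ≫ g = f := by
  have h1 := HomologicalComplex.homologyι_descOpcycles_eq_zero_iff (P.opComplex R Y) n
    (n + 1) _ (by simp) rfl ((homEquivOp R _).symm f) (P.opComplex_d_comp_eq_zero f hf)
  have h2 : P.extClassOfCocycle (R := R) f hf = 0 ↔
      (P.leftDerivedIso R Y n).hom ≫ P.homologyToOp f hf = 0 := by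
    rw [← (ModuleCat.opHomEquiv _).apply_eq_iff_eq, ModuleCat.opHomEquiv_zero]
    rfl
  rw [h2, Preadditive.IsIso.comp_left_eq_zero, homologyToOp, h1]
  constructor
  · rintro ⟨g, hg⟩
    obtain ⟨g, rfl⟩ := (homEquivOp R _).symm.surjective g
    exact ⟨g, (homEquivOp R _).symm.injective ((P.opComplex_d_comp g).symm.trans hg)⟩
  · rintro ⟨g, rfl⟩
    exact ⟨(homEquivOp R _).symm g, P.opComplex_d_comp g⟩

lemma map_extClassOfCocycle (P' : ProjectiveResolution X') (g : X' ⟶ X)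
    (φ : Hom P' P g) {n : ℕ} (f : P.complex.X n ⟶ Y) (hf : P.complex.d (n + 1) n ≫ f = 0) :
    (((Ext R C n).map g.op).app Y) (P.extClassOfCocycle f hf) =
      P'.extClassOfCocycle (φ.hom.f n ≫ f) (by simp [← φ.hom.comm_assoc, hf]) := by
  have h : (((linearYoneda R C).obj Y).rightOp.leftDerived n).map g ≫
      (P.leftDerivedIso R Y n).hom = (P'.leftDerivedIso R Y n).hom ≫
      HomologicalComplex.homologyMap ((((linearYoneda R C).obj Y).rightOp.mapHomologicalComplex
        (ComplexShape.down ℕ)).map φ.hom) n :=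
    isoLeftDerivedObj_hom_naturality g P' P φ.hom
      (by have := φ.hom_f_zero_comp_π_f_zero; rwa [ChainComplex.single₀_map_f_zero] at this)
      ((linearYoneda R C).obj Y).rightOp n
  refine (ModuleCat.opHomEquiv_comp ((((linearYoneda R C).obj Y).rightOp.leftDerived n).map g)
    ((P.leftDerivedIso R Y n).hom ≫ P.homologyToOp f hf)).symm.trans ?_
  unfold extClassOfCocycle
  rw [reassoc_of% h, homologyMap_comp_homologyToOp]

end

end ProjectiveResolution

section Comparison

variable (R : Type u) [CommRing R] {C : Type*} [Category.{u} C] [Abelian C] [Linear R C]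
  [EnoughProjectives C] [HasExt C]

/-- An element of the derived functor `Ext` and an element of `Abelian.Ext` correspond to each
other if they are represented by the same cocycle on a projective resolution. -/
def ExtCorresponds {X Y : C} {n : ℕ} (α : ((Ext R C n).obj (op X)).obj Y)
    (β : Abelian.Ext X Y n) : Prop :=
  ∃ (f : (projectiveResolution X).complex.X n ⟶ Y)
    (hf : (projectiveResolution X).complex.d (n + 1) n ≫ f = 0),
    (projectiveResolution X).extClassOfCocycle f hf = α ∧
      (projectiveResolution X).extMk f (n + 1) rfl hf = β

variable {R} {X X' Y : C} {n : ℕ}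

lemma exists_extCorresponds_left (β : Abelian.Ext X Y n) :
    ∃ α : ((Ext R C n).obj (op X)).obj Y, ExtCorresponds R α β := by
  obtain ⟨f, hf, h⟩ := (projectiveResolution X).extMk_surjective β (n + 1) rfl
  exact ⟨_, f, hf, rfl, h⟩

lemma exists_extCorresponds_right (α : ((Ext R C n).obj (op X)).obj Y) :
    ∃ β : Abelian.Ext X Y n, ExtCorresponds R α β := by
  obtain ⟨f, hf, h⟩ := (projectiveResolution X).exists_extClassOfCocycle_eq α
  exact ⟨_, f, hf, h, rfl⟩

variable {α : ((Ext R C n).obj (op X)).obj Y} {β : Abelian.Ext X Y n}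

lemma ExtCorresponds.eq_zero_iff (h : ExtCorresponds R α β) : α = 0 ↔ β = 0 := by
  obtain ⟨f, hf, rfl, rfl⟩ := h
  rw [ProjectiveResolution.extClassOfCocycle_eq_zero_iff,
    ProjectiveResolution.extMk_eq_zero_iff_next]

lemma ExtCorresponds.precomp (h : ExtCorresponds R α β) (g : X' ⟶ X) :
    ExtCorresponds R (((Ext R C n).map g.op).app Y α)
      ((Abelian.Ext.mk₀ g).comp β (zero_add n)) := by
  obtain ⟨f, hf, rfl, rfl⟩ := h
  let φ : (projectiveResolution X').Hom (projectiveResolution X) g :=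
    ⟨ProjectiveResolution.lift g _ _, by
      rw [ChainComplex.single₀_map_f_zero]; exact ProjectiveResolution.lift_commutes_zero ..⟩
  exact ⟨φ.hom.f n ≫ f, by simp [← φ.hom.comm_assoc, hf],
    (ProjectiveResolution.map_extClassOfCocycle _ _ g φ f hf).symm,
    (ProjectiveResolution.mk₀_comp_extMk f _ _ hf φ).symm⟩

end Comparison

end CategoryTheory

section LocalCohomology

open CategoryTheory Limits Opposite

variable {R : Type u} [CommRing R] (a : Ideal R)

/-- The projection `R ⧸ a ^ m ⟶ R ⧸ a ^ n` for `n ≤ m`. -/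
def quotientPowProj {n m : ℕ} (h : n ≤ m) :
    ModuleCat.of R (R ⧸ a ^ m) ⟶ ModuleCat.of R (R ⧸ a ^ n) :=
  ModuleCat.ofHom (Submodule.mapQ _ _ LinearMap.id (Ideal.pow_le_pow_right h))

/-- The image of `α` in the colimit of the modules `Ext (R ⧸ a ^ m) M i` is zero. -/
def IsEventuallyZero {n i : ℕ} {M : ModuleCat.{u} R}
    (α : Abelian.Ext (ModuleCat.of R (R ⧸ a ^ n)) M i) : Prop :=
  ∃ (m : ℕ) (h : n ≤ m),
    (Abelian.Ext.mk₀ (quotientPowProj a h)).comp α (zero_add i) = 0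

/-- The vanishing of the `i`-th local cohomology, in terms of `Abelian.Ext`. -/
def LocalCohomologyVanishes (i : ℕ) (M : ModuleCat.{u} R) : Prop :=
  ∀ (n : ℕ) (α : Abelian.Ext (ModuleCat.of R (R ⧸ a ^ n)) M i), IsEventuallyZero a α

lemma subsingleton_localCohomology_iff (i : ℕ) (M : ModuleCat.{u} R) :
    Subsingleton ((localCohomology a i).obj M) ↔ LocalCohomologyVanishes a i M := by
  let I := localCohomology.idealPowersDiagram a
  have := localCohomology.hasColimitDiagram.{u, 0} I i
  have := preservesFilteredColimitsOfSize_shrink.{0, u, 0, u} (forget (ModuleCat.{u} R))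
  let F : ℕᵒᵖᵒᵖ ⥤ ModuleCat.{u} R :=
    localCohomology.diagram I i ⋙ (evaluation _ _).obj M
  let c : Cocone F :=
    ((evaluation _ _).obj M).mapCocone (colimit.cocone (localCohomology.diagram I i))
  let hc : IsColimit c := isColimitOfPreserves _ (colimit.isColimit _)
  have key : ∀ (n : ℕ) (x : F.obj (op (op n))), c.ι.app _ x = 0 ↔
      ∃ (m : ℕ) (h : n ≤ m), F.map (homOfLE h).op.op x = 0 := by
    intro n x
    have h0 : c.ι.app (op (op n)) (0 : F.obj (op (op n))) = 0 := map_zero _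
    rw [← h0, Limits.IsColimit.eq_iff' hc]
    constructor
    · rintro ⟨j, f, h⟩
      refine ⟨j.unop.unop, f.unop.unop.le, ?_⟩
      rw [map_zero] at h
      exact h
    · rintro ⟨m, hm, h⟩
      exact ⟨op (op m), (homOfLE hm).op.op, by rw [map_zero]; exact h⟩
  constructor
  · intro hs n β
    obtain ⟨α, hα⟩ := exists_extCorresponds_left (R := R) β
    obtain ⟨m, h, h'⟩ := (key n α).1 (hs.elim _ _)
    exact ⟨m, h, ((hα.precomp (quotientPowProj a h)).eq_zero_iff).1 h'⟩
  · intro hv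
    refine subsingleton_of_forall_eq 0 fun x ↦ ?_
    obtain ⟨⟨⟨n⟩⟩, α, rfl⟩ := Concrete.isColimit_exists_rep F hc x
    obtain ⟨β, hβ⟩ := exists_extCorresponds_right α
    obtain ⟨m, h, h'⟩ := hv n β
    exact (key n α).2 ⟨m, h, ((hβ.precomp (quotientPowProj a h)).eq_zero_iff).2 h'⟩

end LocalCohomology

section EventuallyZero

open Abelian

variable {R : Type u} [CommRing R] {a : Ideal R}

@[simp]
lemma quotientPowProj_comp {n m k : ℕ} (h : n ≤ m) (h' : m ≤ k) :
    quotientPowProj a h' ≫ quotientPowProj a h = quotientPowProj a (h.trans h') := by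
  ext
  rfl

namespace IsEventuallyZero

variable {n i : ℕ} {M N : ModuleCat.{u} R} {α : Ext (ModuleCat.of R (R ⧸ a ^ n)) M i}

lemma of_precomp {m : ℕ} (h : n ≤ m)
    (hα : IsEventuallyZero a ((Ext.mk₀ (quotientPowProj a h)).comp α (zero_add i))) :
    IsEventuallyZero a α := by
  obtain ⟨k, h', hk⟩ := hα
  refine ⟨k, h.trans h', ?_⟩
  rwa [Ext.mk₀_comp_mk₀_assoc, quotientPowProj_comp] at hk

lemma comp (hα : IsEventuallyZero a α) {j k : ℕ} (β : Ext M N j) (hk : i + j = k) :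
    IsEventuallyZero a (α.comp β hk) := by
  obtain ⟨m, h, hm⟩ := hα
  refine ⟨m, h, ?_⟩
  rw [← Ext.comp_assoc _ _ _ (zero_add i) hk (by lia), hm, Ext.zero_comp]

lemma of_eq_zero (h : α = 0) : IsEventuallyZero a α :=
  ⟨n, le_rfl, by simp [h]⟩

variable {S : ShortComplex (ModuleCat.{u} R)} (hS : S.ShortExact)
include hS

lemma of_comp_f {α : Ext (ModuleCat.of R (R ⧸ a ^ n)) S.X₁ (i + 1)}
    (h₃ : LocalCohomologyVanishes a i S.X₃)
    (hα : IsEventuallyZero a (α.comp (Ext.mk₀ S.f) (add_zero _))) : IsEventuallyZero a α := by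
  obtain ⟨m, h, hm⟩ := hα
  refine .of_precomp h ?_
  rw [← Ext.comp_assoc _ _ _ (zero_add _) _ (by lia)] at hm
  obtain ⟨β, hβ⟩ := Ext.covariant_sequence_exact₁ _ hS _ hm rfl
  rw [← hβ]
  exact .comp (h₃ _ β) _ _

lemma of_comp_g {α : Ext (ModuleCat.of R (R ⧸ a ^ n)) S.X₂ i}
    (h₁ : LocalCohomologyVanishes a i S.X₁)
    (hα : IsEventuallyZero a (α.comp (Ext.mk₀ S.g) (add_zero _))) : IsEventuallyZero a α := by
  obtain ⟨m, h, hm⟩ := hα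
  refine .of_precomp h ?_
  rw [← Ext.comp_assoc _ _ _ (zero_add _) _ (by lia)] at hm
  obtain ⟨β, hβ⟩ := Ext.covariant_sequence_exact₂ _ hS _ hm
  rw [← hβ]
  exact .comp (h₁ _ β) _ _

lemma of_comp_extClass {α : Ext (ModuleCat.of R (R ⧸ a ^ n)) S.X₃ i}
    (h₂ : LocalCohomologyVanishes a i S.X₂)
    (hα : IsEventuallyZero a (α.comp hS.extClass rfl)) : IsEventuallyZero a α := by
  obtain ⟨m, h, hm⟩ := hα
  refine .of_precomp h ?_
  rw [← Ext.comp_assoc _ _ _ (zero_add i) _ (by lia)] at hm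
  obtain ⟨β, hβ⟩ := Ext.covariant_sequence_exact₃ _ hS _ rfl hm
  rw [← hβ]
  exact .comp (h₂ _ β) _ _

end IsEventuallyZero

namespace LocalCohomologyVanishes

variable {i : ℕ}

section

variable {S : ShortComplex (ModuleCat.{u} R)} (hS : S.ShortExact)
include hS

lemma of_shortExact₂ (h₁ : LocalCohomologyVanishes a i S.X₁)
    (h₃ : LocalCohomologyVanishes a i S.X₃) : LocalCohomologyVanishes a i S.X₂ :=
  fun _ _ ↦ .of_comp_g hS h₁ (h₃ _ _)

lemma of_shortExact₃ (h₂ : LocalCohomologyVanishes a i S.X₂)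
    (h₁ : LocalCohomologyVanishes a (i + 1) S.X₁) : LocalCohomologyVanishes a i S.X₃ :=
  fun _ _ ↦ .of_comp_extClass hS h₂ (h₁ _ _)

end

lemma of_iso {M N : ModuleCat.{u} R} (e : M ≅ N) (h : LocalCohomologyVanishes a i M) :
    LocalCohomologyVanishes a i N := by
  intro n α
  have : α = (α.comp (Ext.mk₀ e.inv) (add_zero i)).comp (Ext.mk₀ e.hom) (add_zero i) := by
    rw [Ext.comp_assoc _ _ _ _ (zero_add 0) (by lia)]; simp
  rw [this]
  exact .comp (h n _) _ _

lemma of_linearEquiv {M N : Type u} [AddCommGroup M] [Module R M] [AddCommGroup N] [Module R N]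
    (e : M ≃ₗ[R] N) (h : LocalCohomologyVanishes a i (.of R M)) :
    LocalCohomologyVanishes a i (.of R N) :=
  h.of_iso e.toModuleIso

lemma of_subsingleton (M : Type u) [AddCommGroup M] [Module R M] [Subsingleton M] :
    LocalCohomologyVanishes a i (.of R M) := by
  intro n α
  have : 𝟙 (ModuleCat.of R M) = 0 := (ModuleCat.isZero_of_subsingleton _).eq_of_src _ _
  refine .of_eq_zero ?_
  rw [← Ext.comp_mk₀_id α, this, Ext.mk₀_zero, Ext.comp_zero]

/-- If `x ∈ a` is a nonzerodivisor on `N`, vanishing for `N ⧸ x N` implies vanishing for `N`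
in the next degree. -/
lemma of_smul_shortExact {N C : ModuleCat.{u} R} {x : R} (hx : x ∈ a) {g : N ⟶ C}
    {w : (x • 𝟙 N) ≫ g = 0} (hS : (ShortComplex.mk _ g w).ShortExact)
    (hC : LocalCohomologyVanishes a i C) : LocalCohomologyVanishes a (i + 1) N := by
  intro n α
  have hα : x ^ n • α = 0 := by
    have h0 : x ^ n • 𝟙 (ModuleCat.of R (R ⧸ a ^ n)) = 0 := by
      ext
      exact Ideal.Quotient.eq_zero_iff_mem.2 (by simpa using Ideal.pow_mem_pow hx n)
    rw [← Ext.mk₀_id_comp α, ← Ext.smul_comp, ← Ext.mk₀_smul, h0, Ext.mk₀_zero, Ext.zero_comp]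
  suffices H : ∀ (k : ℕ) (β : Ext (ModuleCat.of R (R ⧸ a ^ n)) N (i + 1)),
      IsEventuallyZero a (x ^ k • β) → IsEventuallyZero a β from H n α (.of_eq_zero hα)
  intro k
  induction k with
  | zero => simp
  | succ k ih =>
    intro β hβ
    refine .of_comp_f hS hC (ih _ ?_)
    change IsEventuallyZero a (x ^ k • β.comp (Ext.mk₀ (x • 𝟙 N)) _)
    rwa [← Ext.smul_eq_comp_mk₀, smul_smul, ← pow_succ]

end LocalCohomologyVanishes

end EventuallyZero

section PowTorsion

open Abelian

variable {R : Type u} [CommRing R] (a : Ideal R)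

/-- The submodule of elements killed by some power of the ideal `a`. -/
def Ideal.powTorsion (M : Type*) [AddCommGroup M] [Module R M] : Submodule R M where
  carrier := {x | ∃ n : ℕ, ∀ r ∈ a ^ n, r • x = 0}
  zero_mem' := ⟨0, by simp⟩
  add_mem' := by
    rintro x y ⟨n, hn⟩ ⟨m, hm⟩
    refine ⟨max n m, fun r hr ↦ ?_⟩
    rw [smul_add, hn r (Ideal.pow_le_pow_right (le_max_left _ _) hr),
      hm r (Ideal.pow_le_pow_right (le_max_right _ _) hr), add_zero]
  smul_mem' := by
    rintro s x ⟨n, hn⟩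
    exact ⟨n, fun r hr ↦ by rw [smul_comm, hn r hr, smul_zero]⟩

namespace Ideal

variable {a}

lemma mem_powTorsion {M : Type*} [AddCommGroup M] [Module R M] {x : M} :
    x ∈ a.powTorsion M ↔ ∃ n : ℕ, ∀ r ∈ a ^ n, r • x = 0 := Iff.rfl

lemma map_mem_powTorsion {M N : Type*} [AddCommGroup M] [Module R M] [AddCommGroup N]
    [Module R N] (f : M →ₗ[R] N) {x : M} (hx : x ∈ a.powTorsion M) : f x ∈ a.powTorsion N := by
  obtain ⟨n, hn⟩ := hx
  exact ⟨n, fun r hr ↦ by rw [← map_smul, hn r hr, map_zero]⟩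

lemma powTorsion_powTorsion {M : Type*} [AddCommGroup M] [Module R M] :
    a.powTorsion (a.powTorsion M) = ⊤ := by
  refine eq_top_iff.2 fun x _ ↦ ?_
  obtain ⟨n, hn⟩ := x.2
  exact ⟨n, fun r hr ↦ Subtype.ext (hn r hr)⟩

lemma powTorsion_eq_top_of_surjective {M N : Type*} [AddCommGroup M] [Module R M]
    [AddCommGroup N] [Module R N] (f : M →ₗ[R] N) (hf : Function.Surjective f)
    (hM : a.powTorsion M = ⊤) : a.powTorsion N = ⊤ := by
  refine eq_top_iff.2 fun y _ ↦ ?_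
  obtain ⟨x, rfl⟩ := hf y
  exact map_mem_powTorsion f (hM ▸ Submodule.mem_top)

lemma powTorsion_quotient_pow (n : ℕ) : a.powTorsion (R ⧸ a ^ n) = ⊤ := by
  refine eq_top_iff.2 fun x _ ↦ ?_
  obtain ⟨x, rfl⟩ := Ideal.Quotient.mk_surjective x
  exact ⟨n, fun r hr ↦ Ideal.Quotient.eq_zero_iff_mem.2 (Ideal.mul_mem_right _ _ hr)⟩

lemma exists_pow_smul_eq_zero_of_finite [IsNoetherianRing R] {M : Type*} [AddCommGroup M]
    [Module R M] [Module.Finite R M] (hM : a.powTorsion M = ⊤) :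
    ∃ n : ℕ, a ^ n ≤ Module.annihilator R M := by
  obtain ⟨s, hs⟩ := Module.Finite.fg_top (R := R) (M := M)
  have h (x : M) : ∃ n : ℕ, ∀ r ∈ a ^ n, r • x = 0 := by
    rw [← mem_powTorsion, hM]; trivial
  choose n hn using h
  refine ⟨s.sup n, fun r hr ↦ Module.mem_annihilator.2 fun m ↦ ?_⟩
  have hm : m ∈ Submodule.span R (s : Set M) := hs ▸ Submodule.mem_top
  induction hm using Submodule.span_induction with
  | mem x hx => exact hn x r (Ideal.pow_le_pow_right (Finset.le_sup hx) hr)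
  | zero => simp
  | add x y _ _ hx hy => rw [smul_add, hx, hy, add_zero]
  | smul c x _ hx => rw [smul_comm, hx, smul_zero]

lemma injective_powTorsion [IsNoetherianRing R] (E : Type u) [AddCommGroup E] [Module R E]
    [Module.Injective R E] : Module.Injective R (a.powTorsion E) := by
  refine Module.Baer.injective fun J g ↦ ?_
  have hg : a.powTorsion (LinearMap.range g) = ⊤ := by
    refine eq_top_iff.2 fun x _ ↦ ?_
    obtain ⟨n, hn⟩ := x.1.2
    exact ⟨n, fun r hr ↦ Subtype.ext (Subtype.ext (hn r hr))⟩
  obtain ⟨n, hn⟩ := exists_pow_smul_eq_zero_of_finite hg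
  obtain ⟨k, hk⟩ := Ideal.exists_pow_inf_eq_pow_smul a (M := R) J
  have hJ : a ^ (n + k) ⊓ J ≤ a ^ n * J := by
    have := hk (n + k) (by lia)
    simp only [smul_eq_mul, Ideal.mul_top, Nat.add_sub_cancel] at this
    rw [this]
    exact Ideal.mul_mono_right inf_le_right
  have hgz (x : J) (hx : (x : R) ∈ a ^ n * J) : g x = 0 := by
    obtain ⟨x, hxJ⟩ := x
    suffices ∀ y ∈ a ^ n * J, ∃ h : y ∈ J, g ⟨y, h⟩ = 0 from (this x hx).2
    intro y hy
    induction hy using Submodule.mul_induction_on' with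
    | mem_mul_mem r hr s hs =>
      refine ⟨J.mul_mem_left r hs, ?_⟩
      have := Module.mem_annihilator.1 (hn hr) ⟨g ⟨s, hs⟩, ⟨_, rfl⟩⟩
      have := congrArg Subtype.val this
      rw [Submodule.coe_smul, ← map_smul] at this
      exact this
    | add x _ y _ hx hy =>
      obtain ⟨hx, hx'⟩ := hx
      obtain ⟨hy, hy'⟩ := hy
      refine ⟨J.add_mem hx hy, ?_⟩
      rw [← add_zero (0 : a.powTorsion E)]
      nth_rw 1 [← hx']
      rw [← hy', ← map_add]
      rfl
  let f : J →ₗ[R] R ⧸ a ^ (n + k) := (a ^ (n + k)).mkQ ∘ₗ J.subtype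
  have hfg : LinearMap.ker f ≤ LinearMap.ker ((a.powTorsion E).subtype ∘ₗ g) := by
    intro x hx
    have hx : (x : R) ∈ a ^ (n + k) := Ideal.Quotient.eq_zero_iff_mem.1 hx
    simp [hgz x (hJ ⟨hx, x.2⟩)]
  obtain ⟨φ, hφ⟩ := Module.Injective.out ((LinearMap.ker f).liftQ f le_rfl)
    (LinearMap.ker_eq_bot.1 (Submodule.ker_liftQ_eq_bot _ _ _ le_rfl))
    ((LinearMap.ker f).liftQ _ hfg)
  refine ⟨(φ ∘ₗ (a ^ (n + k)).mkQ).codRestrict _ fun r ↦ map_mem_powTorsion φ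
    (powTorsion_quotient_pow (a := a) (n + k) ▸ Submodule.mem_top : Submodule.mkQ _ r ∈ _),
    fun x hx ↦ Subtype.ext ?_⟩
  exact hφ (Submodule.Quotient.mk ⟨x, hx⟩)

lemma exists_injective_powTorsion_eq_top [IsNoetherianRing R] (N : Type u) [AddCommGroup N]
    [Module R N] (hN : a.powTorsion N = ⊤) :
    ∃ (G : ModuleCat.{u} R) (f : N →ₗ[R] G),
      Function.Injective f ∧ Injective G ∧ a.powTorsion G = ⊤ := by
  let E := Injective.under (ModuleCat.of R N)
  have hE : Injective (ModuleCat.of R E) := Injective.injective_under (ModuleCat.of R N)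
  have : Module.Injective R E := Module.injective_module_of_injective_object R E
  have := injective_powTorsion (a := a) E
  refine ⟨.of R (a.powTorsion E), (Injective.ι (ModuleCat.of R N)).hom.codRestrict _ fun x ↦
    map_mem_powTorsion _ (hN ▸ Submodule.mem_top), ?_,
    Module.injective_object_of_injective_module R (a.powTorsion E), powTorsion_powTorsion⟩
  exact LinearMap.injective_codRestrict_iff _ |>.2
    ((ModuleCat.mono_iff_injective _).1 inferInstance)

end Ideal

variable {a}

lemma LocalCohomologyVanishes.of_powTorsion_eq_top [IsNoetherianRing R] (i : ℕ)
    {N : Type u} [AddCommGroup N] [Module R N] (hN : a.powTorsion N = ⊤) :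
    LocalCohomologyVanishes a (i + 1) (.of R N) := by
  induction i generalizing N with
  | zero =>
    intro n α
    obtain ⟨G, f, hf, _, hG⟩ := Ideal.exists_injective_powTorsion_eq_top N hN
    have hS : (ModuleCat.shortComplexOfCompEqZero f f.range.mkQ
        (LinearMap.range_mkQ_comp f)).ShortExact :=
      ModuleCat.shortComplex_shortExact _ (LinearMap.exact_map_mkQ_range f) hf
        (Submodule.mkQ_surjective _)
    obtain ⟨β, rfl⟩ := Ext.covariant_sequence_exact₁ _ hS α (Ext.eq_zero_of_injective _) rfl
    obtain ⟨b, rfl⟩ := (Ext.mk₀_bijective _ _).2 β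
    obtain ⟨c, hc⟩ := Submodule.mkQ_surjective f.range (b (Ideal.Quotient.mk _ 1))
    obtain ⟨m, hm⟩ := Ideal.mem_powTorsion.1 (hG ▸ Submodule.mem_top : c ∈ a.powTorsion G)
    let l : ModuleCat.of R (R ⧸ a ^ (max n m)) ⟶ G :=
      ModuleCat.ofHom (Submodule.liftQ _ (LinearMap.toSpanSingleton R G c) fun r hr ↦
        hm r (Ideal.pow_le_pow_right (le_max_right _ _) hr))
    refine ⟨max n m, le_max_left _ _, ?_⟩
    have : quotientPowProj a (le_max_left n m) ≫ b = l ≫ ModuleCat.ofHom f.range.mkQ := by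
      ext
      simp only [quotientPowProj, l, ModuleCat.hom_comp, ModuleCat.hom_ofHom]
      exact hc.symm.trans (congrArg f.range.mkQ (one_smul R c).symm)
    rw [Ext.mk₀_comp_mk₀_assoc, this, ← Ext.mk₀_comp_mk₀_assoc, hS.comp_extClass, Ext.comp_zero]
  | succ i ih =>
    intro n α
    obtain ⟨G, f, hf, _, hG⟩ := Ideal.exists_injective_powTorsion_eq_top N hN
    have hS : (ModuleCat.shortComplexOfCompEqZero f f.range.mkQ
        (LinearMap.range_mkQ_comp f)).ShortExact :=
      ModuleCat.shortComplex_shortExact _ (LinearMap.exact_map_mkQ_range f) hf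
        (Submodule.mkQ_surjective _)
    exact .of_comp_f hS (ih (Ideal.powTorsion_eq_top_of_surjective _
      (Submodule.mkQ_surjective f.range) hG)) (.of_eq_zero (Ext.eq_zero_of_injective _))

end PowTorsion

section Support

variable {R : Type u} [CommRing R] {a : Ideal R}

namespace LocalCohomologyVanishes

variable {i : ℕ}

section Exact

variable {M₁ M₂ M₃ : Type u} [AddCommGroup M₁] [Module R M₁] [AddCommGroup M₂] [Module R M₂]
  [AddCommGroup M₃] [Module R M₃] {f : M₁ →ₗ[R] M₂} {g : M₂ →ₗ[R] M₃}
  (hf : Function.Injective f) (hg : Function.Surjective g) (hfg : Function.Exact f g)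
include hf hg hfg

lemma of_exact₂ (h₁ : LocalCohomologyVanishes a i (.of R M₁))
    (h₃ : LocalCohomologyVanishes a i (.of R M₃)) : LocalCohomologyVanishes a i (.of R M₂) :=
  of_shortExact₂ (ModuleCat.shortComplex_shortExact
    (ModuleCat.shortComplexOfCompEqZero f g hfg.linearMap_comp_eq_zero) hfg hf hg) h₁ h₃

lemma of_exact₃ (h₂ : LocalCohomologyVanishes a i (.of R M₂))
    (h₁ : LocalCohomologyVanishes a (i + 1) (.of R M₁)) :
    LocalCohomologyVanishes a i (.of R M₃) :=
  of_shortExact₃ (ModuleCat.shortComplex_shortExact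
    (ModuleCat.shortComplexOfCompEqZero f g hfg.linearMap_comp_eq_zero) hfg hf hg) h₂ h₁

omit hf hfg in
lemma of_surjective (h₂ : LocalCohomologyVanishes a i (.of R M₂))
    (h₁ : LocalCohomologyVanishes a (i + 1) (.of R (LinearMap.ker g))) :
    LocalCohomologyVanishes a i (.of R M₃) :=
  of_exact₃ (LinearMap.ker g).injective_subtype hg g.exact_subtype_ker_map h₂ h₁

end Exact

variable [IsNoetherianRing R]

lemma of_forall_mem_support {M : Type u} [AddCommGroup M] [Module R M] [Module.Finite R M]
    (h : ∀ p ∈ Module.support R M, LocalCohomologyVanishes a i (.of R (R ⧸ p.asIdeal))) :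
    LocalCohomologyVanishes a i (.of R M) := by
  revert h
  refine IsNoetherianRing.induction_on_isQuotientEquivQuotientPrime R ‹Module.Finite R M›
    (motive := fun N _ _ _ ↦ (∀ p ∈ Module.support R N,
      LocalCohomologyVanishes a i (.of R (R ⧸ p.asIdeal))) →
      LocalCohomologyVanishes a i (.of R N)) ?_ ?_ ?_
  · intro N _ _ _ _ _
    exact of_subsingleton N
  · intro N _ _ _ p e h
    refine of_linearEquiv e.symm (h p ?_)
    rw [e.support_eq, Module.mem_support_iff_of_finite, Ideal.annihilator_quotient]
  · intro N₁ _ _ _ N₂ _ _ _ N₃ _ _ _ f g hf hg hfg h₁ h₃ h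
    exact of_exact₂ hf hg hfg
      (h₁ fun p hp ↦ h p (Module.support_subset_of_injective f hf hp))
      (h₃ fun p hp ↦ h p (Module.support_subset_of_surjective g hg hp))

lemma quotient_of_ringKrullDim_lt (d : ℕ) (p : PrimeSpectrum R)
    (hp : ringKrullDim (R ⧸ p.asIdeal) < d) (hi : d ≤ i) :
    LocalCohomologyVanishes a i (.of R (R ⧸ p.asIdeal)) := by
  induction d generalizing p i with
  | zero => exact absurd hp (not_lt.2 ringKrullDim_nonneg_of_nontrivial)
  | succ d ih =>
    obtain ⟨i, rfl⟩ := Nat.exists_eq_add_of_le' hi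
    rw [← add_assoc]
    by_cases hap : a ≤ p.asIdeal
    · refine of_powTorsion_eq_top _ (eq_top_iff.2 fun y _ ↦ ⟨1, fun r hr ↦ ?_⟩)
      obtain ⟨y, rfl⟩ := Ideal.Quotient.mk_surjective y
      exact Ideal.Quotient.eq_zero_iff_mem.2
        (Ideal.mul_mem_right _ _ (hap (by simpa using hr)))
    · obtain ⟨x, hxa, hxp⟩ := SetLike.not_le_iff_exists.1 hap
      let f : (R ⧸ p.asIdeal) →ₗ[R] (R ⧸ p.asIdeal) := LinearMap.lsmul R _ x
      have hx0 : Ideal.Quotient.mk p.asIdeal x ≠ 0 := by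
        rwa [ne_eq, Ideal.Quotient.eq_zero_iff_mem]
      have hf : Function.Injective f := by
        refine (injective_iff_map_eq_zero f).2 fun y hy ↦ ?_
        exact (mul_eq_zero.1 (show Ideal.Quotient.mk p.asIdeal x * y = 0 from hy)).resolve_left hx0
      have hS : (ModuleCat.shortComplexOfCompEqZero f f.range.mkQ
          (LinearMap.range_mkQ_comp f)).ShortExact :=
        ModuleCat.shortComplex_shortExact _ (LinearMap.exact_map_mkQ_range f) hf
          (Submodule.mkQ_surjective _)
      refine of_smul_shortExact hxa hS (of_forall_mem_support fun q hq ↦ ih q ?_ (by lia))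
      rw [Module.mem_support_iff_of_finite] at hq
      have hpq : p.asIdeal ≤ q.asIdeal := fun r hr ↦ hq <| Module.mem_annihilator.2 fun m ↦ by
        obtain ⟨m, rfl⟩ := Submodule.mkQ_surjective _ m
        obtain ⟨m, rfl⟩ := Ideal.Quotient.mk_surjective m
        rw [← map_smul, show r • Ideal.Quotient.mk p.asIdeal m = 0 from
          Ideal.Quotient.eq_zero_iff_mem.2 (Ideal.mul_mem_right _ _ hr), map_zero]
      have hxq : x ∈ q.asIdeal := hq <| Module.mem_annihilator.2 fun m ↦ by
        obtain ⟨m, rfl⟩ := Submodule.mkQ_surjective _ m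
        rw [← map_smul]
        exact (Submodule.Quotient.mk_eq_zero _).2 ⟨m, rfl⟩
      have := ringKrullDim_succ_le_of_surjective (Ideal.Quotient.factor hpq)
        (Ideal.Quotient.factor_surjective hpq) (mem_nonZeroDivisors_of_ne_zero hx0)
        (by simpa [Ideal.Quotient.eq_zero_iff_mem] using hxq)
      by_contra! hd
      refine (this.trans_lt hp).not_ge ?_
      push_cast
      gcongr

lemma quotient_of_mem_support_of_succ {M : Type u} [AddCommGroup M] [Module R M]
    [Module.Finite R M] (hM : LocalCohomologyVanishes a i (.of R M))
    (hsucc : ∀ p ∈ Module.support R M,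
      LocalCohomologyVanishes a (i + 1) (.of R (R ⧸ p.asIdeal)))
    (p : PrimeSpectrum R) (hp : p ∈ Module.support R M) :
    LocalCohomologyVanishes a i (.of R (R ⧸ p.asIdeal)) := by
  have : WellFoundedGT (PrimeSpectrum R) :=
    ⟨(InvImage.wf PrimeSpectrum.asIdeal (wellFounded_gt (α := Ideal R)))⟩
  induction p using WellFoundedGT.induction with
  | ind p ih =>
  obtain ⟨K, hK⟩ := exists_maximal_of_wellFoundedGT
    (P := fun K : Submodule R M ↦ p ∈ Module.support R (M ⧸ K))
    ⟨⊥, by rwa [(Submodule.quotEquivOfEqBot (⊥ : Submodule R M) rfl).support_eq]⟩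
  have hmax (L : Submodule R (M ⧸ K)) (hL : p ∈ Module.support R ((M ⧸ K) ⧸ L)) : L = ⊥ := by
    have hL' : p ∈ Module.support R (M ⧸ L.comap K.mkQ) :=
      Module.support_subset_of_surjective ((L.comap K.mkQ).mapQ L K.mkQ le_rfl)
        (.of_comp (g := Submodule.mkQ _) (L.mkQ_surjective.comp K.mkQ_surjective)) hL
    have := hK.le_of_ge hL' (by simpa using LinearMap.ker_le_comap K.mkQ (p := L))
    rw [eq_bot_iff, ← Submodule.map_comap_eq_of_surjective K.mkQ_surjective L]
    exact (Submodule.map_mono this).trans (by simp)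
  have hpK (r : R) (hr : r ∈ p.asIdeal) (y : M ⧸ K) : r • y = 0 := by
    have := hmax (p.asIdeal • ⊤) (by
      rw [Module.support_quotient]
      exact ⟨hK.1, fun _ hr ↦ hr⟩)
    rw [← Submodule.mem_bot R, ← this]
    exact Submodule.smul_mem_smul hr trivial
  have : Nontrivial (M ⧸ K) := Module.nonempty_support_iff.1 ⟨p, hK.1⟩
  obtain ⟨x, hx⟩ := exists_ne (0 : M ⧸ K)
  let L := Submodule.span R {x}
  obtain ⟨s, hs, hsp⟩ : ∃ s ∈ Module.annihilator R ((M ⧸ K) ⧸ L), s ∉ p.asIdeal := by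
    rw [← SetLike.not_le_iff_exists, ← Module.mem_support_iff_of_finite]
    exact fun h ↦ hx (Submodule.span_singleton_eq_bot.1 (hmax _ h))
  have hsL (y : M ⧸ K) : s • y ∈ L := by
    rw [← Submodule.Quotient.mk_eq_zero, Submodule.Quotient.mk_smul]
    exact Module.mem_annihilator.1 hs _
  let f : (M ⧸ K) →ₗ[R] L := (LinearMap.lsmul R _ s).codRestrict L hsL
  have hxp : Ideal.torsionOf R (M ⧸ K) x = p.asIdeal := by
    refine le_antisymm (fun r hr ↦ ?_) fun r hr ↦ hpK r hr x
    have hrs : r * s ∈ Module.annihilator R (M ⧸ K) := Module.mem_annihilator.2 fun y ↦ ?_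
    · exact (p.2.mem_or_mem (Module.mem_support_iff_of_finite.1 hK.1 hrs)).resolve_right hsp
    obtain ⟨t, ht⟩ := Submodule.mem_span_singleton.1 (hsL y)
    rw [mul_smul, ← ht, smul_comm, (Ideal.mem_torsionOf_iff x r).1 hr, smul_zero]
  have e : L ≃ₗ[R] R ⧸ p.asIdeal := (Ideal.quotTorsionOfEquivSpanSingleton R _ x).symm ≪≫ₗ
    Submodule.quotEquivOfEq _ _ hxp
  let g : M →ₗ[R] f.range := f.rangeRestrict ∘ₗ K.mkQ
  have hg : Function.Surjective g := f.surjective_rangeRestrict.comp K.mkQ_surjective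
  have hJ : LocalCohomologyVanishes a i (.of R f.range) :=
    of_surjective hg hM <| of_forall_mem_support fun q hq ↦
        hsucc q (Module.support_subset_of_injective _ (LinearMap.ker g).injective_subtype hq)
  refine of_linearEquiv e (of_exact₂ f.range.injective_subtype f.range.mkQ_surjective
    (LinearMap.exact_subtype_mkQ _) hJ (of_forall_mem_support fun q hq ↦ ?_))
  rw [Module.mem_support_iff_of_finite] at hq
  have hpq : p < q := by
    refine PrimeSpectrum.asIdeal_lt_asIdeal _ _ |>.1 <| SetLike.lt_iff_le_and_exists.2
      ⟨fun r hr ↦ hq ?_, s, hq ?_, hsp⟩ <;>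
    refine Module.mem_annihilator.2 fun y ↦ ?_ <;>
    obtain ⟨y, rfl⟩ := Submodule.mkQ_surjective _ y <;>
    rw [← map_smul]
    · rw [show r • y = 0 from Subtype.ext (hpK r hr y), map_zero]
    · exact (Submodule.Quotient.mk_eq_zero _).2 ⟨y, rfl⟩
  exact ih q hpq (Module.mem_support_mono hpq.le hp)

lemma quotient_of_mem_support (hR : ringKrullDim R ≠ ⊤) {M : Type u} [AddCommGroup M]
    [Module R M] [Module.Finite R M] {c : ℕ}
    (hM : ∀ i, c ≤ i → LocalCohomologyVanishes a i (.of R M)) (hi : c ≤ i)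
    (p : PrimeSpectrum R) (hp : p ∈ Module.support R M) :
    LocalCohomologyVanishes a i (.of R (R ⧸ p.asIdeal)) := by
  obtain ⟨d, hd⟩ : ∃ d : ℕ, ringKrullDim R < d := by
    revert hR
    cases ringKrullDim R with
    | bot => exact fun _ ↦ ⟨0, WithBot.bot_lt_coe _⟩
    | coe n =>
      cases n with
      | top => exact fun h ↦ absurd rfl h
      | coe n => exact fun _ ↦ ⟨n + 1, by exact_mod_cast n.lt_succ_self⟩
  suffices ∀ k i, c ≤ i → d ≤ i + k → ∀ p ∈ Module.support R M,
    LocalCohomologyVanishes a i (.of R (R ⧸ p.asIdeal)) from this d i hi (by lia) p hp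
  intro k
  induction k with
  | zero =>
    exact fun i _ hdi p _ ↦
      quotient_of_ringKrullDim_lt d p ((ringKrullDim_quotient_le _).trans_lt hd) hdi
  | succ k ih =>
    exact fun i hci hdi ↦
      quotient_of_mem_support_of_succ (hM i hci) (ih (i + 1) (by lia) (by lia))

end LocalCohomologyVanishes

end Support

/-- Theorem 3.1, module case: over a commutative Noetherian ring `R` of finite Krull
dimension, for a finitely generated `R`-module `M`,
`cd(a, M) = sup { cd(a, R/p) : p ∈ Supp_R M }`. -/
theorem cohDim_eq_iSup_cohDim_quotient (R : Type u) [CommRing R] [IsNoetherianRing R]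
    (hfin : ringKrullDim R ≠ ⊤) (a : Ideal R)
    (M : ModuleCat.{u} R) [Module.Finite R M] :
    cohDim R a M
      = ⨆ p ∈ Module.support R M, cohDim R a (ModuleCat.of R (R ⧸ p.asIdeal)) := by
  simp only [cohDim, Set.mem_ofPred_eq, subsingleton_localCohomology_iff]
  refine le_antisymm (iSup₂_le fun i hi ↦ ?_) (iSup₂_le fun p hp ↦ iSup₂_le fun i hi ↦ ?_)
  · obtain ⟨p, hp, h⟩ : ∃ p ∈ Module.support R M,
        ¬ LocalCohomologyVanishes a i (.of R (R ⧸ p.asIdeal)) := by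
      contrapose! hi
      exact .of_forall_mem_support hi
    exact le_iSup₂_of_le p hp (le_iSup₂_of_le i h le_rfl)
  · obtain ⟨j, hij, h⟩ : ∃ j, i ≤ j ∧ ¬ LocalCohomologyVanishes a j M := by
      contrapose! hi
      exact .quotient_of_mem_support hfin hi le_rfl p hp
    exact le_iSup₂_of_le j h (by exact_mod_cast hij)
end
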